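/- Suppose the magnetic field is constant: B ≡ B̂₀ with B̂₀ > 0 and B̂₀ ∈ 2πℤ, and take A^per = 0. Then there exist constants C₀ > 0 and N₀ ∈ ℕ such that for every λ ≥ 0, every u ∈ C^∞(𝕋²,L) with 𝓛_α u = λ² u and ‖u‖_{L²} = 1, and every smooth ℤ²-periodic a : ℝ² → ℂ, one has |∫_{[0,1]²} a(x)|u(x)|² dx − ∫_{[0,1]²} a(x) dx| ≤ C₀ ‖a‖_{C^{N₀}} (1+λ)^{−1/2}, where ‖a‖_{C^{N₀}} is the supremum over [0,1]² of all partial derivatives of a of order at most N₀. -/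

import Mathlib

open MeasureTheory Filter Topology
open scoped Real ENNReal

noncomputable section

abbrev Pt : Type := ℝ × ℝ

/-- `v ∧ w = v₁w₂ - v₂w₁`. -/
def wedge (v w : Pt) : ℝ := v.1 * w.2 - v.2 * w.1

/-- Euclidean dot product on `ℝ²`. -/
def dotp (v w : Pt) : ℝ := v.1 * w.1 + v.2 * w.2

/-- The fundamental domain `[0,1]²` of the torus `𝕋² = ℝ²/ℤ²`. -/
def fund : Set Pt := Set.Icc (0, 0) (1, 1)

/-- `ℤ²`-periodicity of a function on `ℝ²`. -/
def IsPeriodic {E : Type*} (f : Pt → E) : Prop :=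
  ∀ (m : ℤ × ℤ) (x : Pt), f (x.1 + m.1, x.2 + m.2) = f x

/-- The magnetic translation `𝒯_m^B` associated to the flux `B0 = B̂₀`. -/
def magTrans (B0 : ℝ) (m : ℤ × ℤ) (u : Pt → ℂ) : Pt → ℂ := fun x =>
  Complex.exp (Complex.I * (B0 / 2) * (wedge ((m.1 : ℝ), (m.2 : ℝ)) x : ℝ)) *
    u (x.1 - m.1, x.2 - m.2)

/-- First partial derivative of a complex valued function on `ℝ²`. -/
def pd1 (u : Pt → ℂ) : Pt → ℂ := fun x => fderiv ℝ u x (1, 0)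

/-- Second partial derivative of a complex valued function on `ℝ²`. -/
def pd2 (u : Pt → ℂ) : Pt → ℂ := fun x => fderiv ℝ u x (0, 1)

/-- First partial derivative of a real valued function on `ℝ²`. -/
def pdR1 (f : Pt → ℝ) : Pt → ℝ := fun x => fderiv ℝ f x (1, 0)

/-- Second partial derivative of a real valued function on `ℝ²`. -/
def pdR2 (f : Pt → ℝ) : Pt → ℝ := fun x => fderiv ℝ f x (0, 1)

/-- The vector potential `A⁰(x₁,x₂) = (B̂₀/2)(−x₂, x₁)`. -/
def A0 (B0 : ℝ) : Pt → Pt := fun x => (B0 / 2 * (-x.2), B0 / 2 * x.1)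

/-- `(-i∂₁ - α₁ - A₁) u`. -/
def Dop1 (α : Pt) (A : Pt → Pt) (u : Pt → ℂ) : Pt → ℂ := fun x =>
  -Complex.I * pd1 u x - ((α.1 + (A x).1 : ℝ) : ℂ) * u x

/-- `(-i∂₂ - α₂ - A₂) u`. -/
def Dop2 (α : Pt) (A : Pt → Pt) (u : Pt → ℂ) : Pt → ℂ := fun x =>
  -Complex.I * pd2 u x - ((α.2 + (A x).2 : ℝ) : ℂ) * u x

/-- The magnetic Laplacian `𝓛_α u = (−i∂₁−α₁−A₁)²u + (−i∂₂−α₂−A₂)²u`. -/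
def magLap (α : Pt) (A : Pt → Pt) (u : Pt → ℂ) : Pt → ℂ := fun x =>
  Dop1 α A (Dop1 α A u) x + Dop2 α A (Dop2 α A u) x

/-- Membership in `C^∞(𝕋²,L)`: smooth and invariant under all magnetic translations. -/
def MemCL (B0 : ℝ) (u : Pt → ℂ) : Prop :=
  ContDiff ℝ (⊤ : ℕ∞) u ∧ ∀ m : ℤ × ℤ, magTrans B0 m u = u

end

/-- The `C^N` norm of `a`: supremum over `[0,1]²` of all derivatives of order `≤ N`. -/
noncomputable def CNorm (N : ℕ) (a : Pt → ℂ) : ℝ :=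
  ⨆ (k : Fin (N + 1)) (x : fund), ‖iteratedFDeriv ℝ (k : ℕ) a (x : Pt)‖

section

theorem fund_eq_prod : fund = Set.Icc (0 : ℝ) 1 ×ˢ Set.Icc (0 : ℝ) 1 := by
  rw [fund, Set.Icc_prod_eq]

theorem isCompact_fund : IsCompact fund := isCompact_Icc

theorem integrableOn_fund {E : Type*} [NormedAddCommGroup E] {f : Pt → E} (hf : Continuous f) :
    IntegrableOn f fund :=
  hf.continuousOn.integrableOn_compact isCompact_fund

theorem volume_real_fund : volume.real fund = 1 := by
  rw [fund_eq_prod, measureReal_def, Measure.volume_eq_prod, Measure.prod_prod]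
  simp

/-- The integral over the fundamental domain as an iterated integral. -/
theorem setIntegral_fund_eq {E : Type*} [NormedAddCommGroup E] [NormedSpace ℝ E]
    {f : Pt → E} (hf : Continuous f) :
    ∫ x in fund, f x = ∫ x in (0 : ℝ)..1, ∫ y in (0 : ℝ)..1, f (x, y) := by
  have h := integrableOn_fund hf
  rw [fund_eq_prod, Measure.volume_eq_prod] at h ⊢
  rw [setIntegral_prod f h]
  simp only [intervalIntegral.integral_of_le zero_le_one, integral_Icc_eq_integral_Ioc]

/-- Integrals of periodic functions over the fundamental domain are translation invariant. -/
theorem IsPeriodic.setIntegral_fund_add {E : Type*} [NormedAddCommGroup E] [NormedSpace ℝ E]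
    {f : Pt → E} (hp : IsPeriodic f) (hf : Continuous f) (c : Pt) :
    ∫ x in fund, f (x + c) = ∫ x in fund, f x := by
  rw [setIntegral_fund_eq hf, setIntegral_fund_eq (by fun_prop : Continuous fun x ↦ f (x + c))]
  have h1 : Function.Periodic (fun x ↦ ∫ y in (0 : ℝ)..1, f (x, y)) 1 := fun x ↦ by
    refine intervalIntegral.integral_congr fun y _ ↦ ?_
    simpa using hp (1, 0) (x, y)
  have h2 : ∀ x, Function.Periodic (fun y ↦ f (x, y)) 1 := fun x y ↦ by
    simpa using hp (0, 1) (x, y)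
  have h3 : ∀ x, ∫ y in (0 : ℝ)..1, f ((x, y) + c) = ∫ y in (0 : ℝ)..1, f (x + c.1, y) := by
    intro x
    have := (h2 (x + c.1)).intervalIntegral_add_eq c.2 0
    rw [zero_add] at this
    rw [← this, add_comm c.2 1]
    change ∫ y in (0 : ℝ)..1, f (x + c.1, y + c.2) = _
    simpa using intervalIntegral.integral_comp_add_right (fun y ↦ f (x + c.1, y)) c.2
      (a := 0) (b := 1)
  simp only [h3]
  have := h1.intervalIntegral_add_eq c.1 0
  rw [zero_add] at this
  rw [← this, add_comm c.1 1]
  simpa using intervalIntegral.integral_comp_add_right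
    (fun x ↦ ∫ y in (0 : ℝ)..1, f (x, y)) c.1 (a := 0) (b := 1)

/-- Differentiation under the integral over the fundamental domain. -/
theorem hasDerivAt_setIntegral_fund {K K' : ℝ → Pt → ℂ} (hK : ∀ r, Continuous (K r))
    (hK' : Continuous fun p : ℝ × Pt ↦ K' p.1 p.2)
    (hd : ∀ r x, HasDerivAt (fun s ↦ K s x) (K' r x) r) (r : ℝ) :
    HasDerivAt (fun s ↦ ∫ x in fund, K s x) (∫ x in fund, K' r x) r := by
  obtain ⟨C, hC⟩ := ((isCompact_closedBall r 1).prod isCompact_fund).exists_bound_of_continuousOn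
    hK'.continuousOn
  refine (hasDerivAt_integral_of_dominated_loc_of_deriv_le (F' := K') (bound := fun _ ↦ C)
    (Metric.closedBall_mem_nhds r one_pos) ?_ (integrableOn_fund (hK r)) ?_ ?_ ?_ ?_).2
  · exact .of_forall fun s ↦ (hK s).aestronglyMeasurable
  · exact (by fun_prop : Continuous (K' r)).aestronglyMeasurable
  · refine (ae_restrict_iff' measurableSet_Icc).2 (.of_forall fun x hx s hs ↦ hC (s, x) ⟨hs, hx⟩)
  · exact integrableOn_const (isCompact_fund.measure_lt_top.ne)
  · exact .of_forall fun x s _ ↦ hd s x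

/-- The integral of a derivative of a periodic function vanishes. -/
theorem IsPeriodic.setIntegral_fderiv_eq_zero {f : Pt → ℂ} (hp : IsPeriodic f)
    (hf : ContDiff ℝ 1 f) (v : Pt) : ∫ x in fund, fderiv ℝ f x v = 0 := by
  have hc := hf.continuous_fderiv one_ne_zero
  have h := hasDerivAt_setIntegral_fund (K := fun r x ↦ f (x + r • v))
    (K' := fun r x ↦ fderiv ℝ f (x + r • v) v) (fun r ↦ by have := hf.continuous; fun_prop)
    (by fun_prop) (fun r x ↦ by
      have h1 : HasDerivAt (fun s : ℝ ↦ x + s • v) v r := by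
        simpa using ((hasDerivAt_id r).smul_const v).const_add x
      exact ((hf.differentiable one_ne_zero _).hasFDerivAt.comp_hasDerivAt r h1)) 0
  simp only [fun r : ℝ ↦ hp.setIntegral_fund_add hf.continuous (r • v)] at h
  simpa using h.unique (hasDerivAt_const _ _)

/-- Decay of bounded solutions of the radial harmonic oscillator equation
`g'' + g' / r + (l² - b² r² / 4) g = 0` inside the classically allowed region. -/
theorem radial_oscillator_bound {b l : ℝ} (hl : 0 ≤ l) {g h : ℝ → ℝ}
    (hg : ∀ r, 0 < r → HasDerivAt g (h r) r)
    (hh : ∀ r, 0 < r → HasDerivAt h (-(l ^ 2 - b ^ 2 * r ^ 2 / 4) * g r - h r / r) r)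
    (hg1 : ∀ r, |g r| ≤ 1) (hh1 : ∀ r, |h r| ≤ l)
    {ρ : ℝ} (hρ : 0 < ρ) (hbρ : b ^ 2 * ρ ^ 2 ≤ 2 * l ^ 2) : l * ρ * g ρ ^ 2 ≤ 7 := by
  have hgsq : ∀ r, g r ^ 2 ≤ 1 := fun r ↦ (sq_le_one_iff_abs_le_one _).2 (hg1 r)
  rcases hl.eq_or_lt with rfl | hl
  · simp
  rcases le_or_gt (l * ρ) 1 with hlρ | hlρ
  · nlinarith [hgsq ρ, mul_pos hl hρ, sq_nonneg (g ρ)]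
  have hr0 : 1 / l ≤ ρ := by rw [div_le_iff₀ hl]; linarith
  have hr0' : 0 < 1 / l := by positivity
  let M : ℝ → ℝ := fun r ↦
    r * h r ^ 2 + g r * h r + (1 / 2 * r⁻¹ + (l ^ 2 - b ^ 2 * r ^ 2 / 4) * r) * g r ^ 2
  have hM : ∀ r, 0 < r → HasDerivAt M (-(b ^ 2 * r ^ 2 / 2 + 1 / (2 * r ^ 2)) * g r ^ 2) r := by
    intro r hr
    have h1 := ((hasDerivAt_id r).mul ((hh r hr).pow 2)).add ((hg r hr).mul (hh r hr))
    have h2 := ((hasDerivAt_inv hr.ne').const_mul (1 / 2)).add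
      (((((hasDerivAt_id r).pow 2).const_mul (b ^ 2)).div_const 4 |>.const_sub (l ^ 2)).mul
        (hasDerivAt_id r))
    refine (h1.add (h2.mul ((hg r hr).pow 2))).congr_deriv ?_
    simp
    field_simp
    ring
  have hanti : AntitoneOn M (Set.Icc (1 / l) ρ) := by
    refine antitoneOn_of_deriv_nonpos (convex_Icc _ _)
      (fun r hr ↦ (hM r (hr0'.trans_le hr.1)).continuousAt.continuousWithinAt) ?_ ?_
    · rw [interior_Icc]
      exact fun r hr ↦ (hM r (hr0'.trans hr.1)).differentiableAt.differentiableWithinAt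
    · rw [interior_Icc]
      intro r hr
      rw [(hM r (hr0'.trans hr.1)).deriv, neg_mul, neg_nonpos]
      positivity
  have hle := hanti ⟨le_rfl, hr0⟩ ⟨hr0, le_rfl⟩ hr0
  have hlow : l ^ 2 / 2 * ρ * g ρ ^ 2 ≤ M ρ := by
    have e : M ρ - l ^ 2 / 2 * ρ * g ρ ^ 2 = ρ * (h ρ + g ρ / (2 * ρ)) ^ 2 + g ρ ^ 2 / (4 * ρ) +
        (2 * l ^ 2 - b ^ 2 * ρ ^ 2) / 4 * ρ * g ρ ^ 2 := by
      simp only [M]; field_simp; ring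
    have : 0 ≤ 2 * l ^ 2 - b ^ 2 * ρ ^ 2 := by linarith
    have : 0 ≤ M ρ - l ^ 2 / 2 * ρ * g ρ ^ 2 := by rw [e]; positivity
    linarith
  have hup : M (1 / l) ≤ 7 / 2 * l := by
    have h1 : 1 / l * h (1 / l) ^ 2 ≤ l := by
      have := sq_le_sq' (neg_le_of_abs_le (hh1 (1 / l))) (le_of_abs_le (hh1 (1 / l)))
      rw [div_mul_eq_mul_div, one_mul, div_le_iff₀ hl]; nlinarith
    have h2 : g (1 / l) * h (1 / l) ≤ l := by
      refine (le_abs_self _).trans ?_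
      rw [abs_mul]
      nlinarith [hg1 (1 / l), hh1 (1 / l), abs_nonneg (g (1 / l)), abs_nonneg (h (1 / l))]
    have h3 : (1 / 2 * (1 / l)⁻¹ + (l ^ 2 - b ^ 2 * (1 / l) ^ 2 / 4) * (1 / l)) * g (1 / l) ^ 2
        ≤ 3 / 2 * l := by
      have e : 1 / 2 * (1 / l)⁻¹ + (l ^ 2 - b ^ 2 * (1 / l) ^ 2 / 4) * (1 / l) =
        3 / 2 * l - b ^ 2 * (1 / l) ^ 3 / 4 := by field_simp; ring
      have : 0 ≤ b ^ 2 * (1 / l) ^ 3 / 4 := by positivity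
      rw [e]
      nlinarith [hgsq (1 / l), sq_nonneg (g (1 / l)), mul_nonneg this (sq_nonneg (g (1 / l)))]
    simp only [M]; linarith
  have : l * (l * ρ * g ρ ^ 2) ≤ l * 7 := by nlinarith
  exact le_of_mul_le_mul_left this hl

open Complex ComplexConjugate

/-- `wedge v` as a continuous linear form. -/
def wedgeCLM (v : Pt) : Pt →L[ℝ] ℝ :=
  v.1 • ContinuousLinearMap.snd ℝ ℝ ℝ - v.2 • ContinuousLinearMap.fst ℝ ℝ ℝ

@[simp] theorem wedgeCLM_apply (v x : Pt) : wedgeCLM v x = wedge v x := by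
  simp [wedgeCLM, wedge]

theorem wedge_add_left (v w x : Pt) : wedge (v + w) x = wedge v x + wedge w x := by
  simp [wedge]; ring

theorem wedge_add_right (v w x : Pt) : wedge x (v + w) = wedge x v + wedge x w := by
  simp [wedge]; ring

theorem wedge_smul_left (s : ℝ) (v x : Pt) : wedge (s • v) x = s * wedge v x := by
  simp [wedge]; ring

theorem wedge_swap (v w : Pt) : wedge v w = -wedge w v := by
  simp [wedge]; ring

theorem wedge_self (v : Pt) : wedge v v = 0 := by
  simp [wedge]; ring

/-- The covariant derivative `-i∂_v - α·v - A⁰·v` in the direction `v`. -/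
noncomputable def covD (B : ℝ) (α v : Pt) (u : Pt → ℂ) : Pt → ℂ := fun x ↦
  -I * fderiv ℝ u x v - ((dotp α v + B / 2 * wedge x v : ℝ) : ℂ) * u x

/-- Translation by `c` followed by multiplication by the phase `exp (i (θ + L x))`. -/
noncomputable def twist (θ : ℝ) (L : Pt →L[ℝ] ℝ) (c : Pt) (u : Pt → ℂ) : Pt → ℂ := fun x ↦
  cexp (((θ + L x : ℝ) : ℂ) * I) * u (x + c)

theorem norm_twist (θ : ℝ) (L : Pt →L[ℝ] ℝ) (c : Pt) (u : Pt → ℂ) (x : Pt) :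
    ‖twist θ L c u x‖ = ‖u (x + c)‖ := by
  rw [twist, norm_mul, norm_exp_ofReal_mul_I, one_mul]

theorem contDiff_twist {n : ℕ∞} (θ : ℝ) (L : Pt →L[ℝ] ℝ) (c : Pt) {u : Pt → ℂ}
    (hu : ContDiff ℝ n u) : ContDiff ℝ n (twist θ L c u) := by
  have h : ContDiff ℝ n fun x ↦ θ + L x := by fun_prop
  exact ((ofRealCLM.contDiff.comp h).mul contDiff_const).cexp.mul (by fun_prop)

theorem fderiv_twist (θ : ℝ) (L : Pt →L[ℝ] ℝ) (c : Pt) {u : Pt → ℂ}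
    (hu : Differentiable ℝ u) (x v : Pt) :
    fderiv ℝ (twist θ L c u) x v =
      cexp (((θ + L x : ℝ) : ℂ) * I) * (L v * I * u (x + c) + fderiv ℝ u (x + c) v) := by
  have h1 : HasFDerivAt (fun y ↦ ((θ + L y : ℝ) : ℂ) * I)
      ((ofRealCLM.comp L).smulRight I) x :=
    (((ofRealCLM.hasFDerivAt).comp x (L.hasFDerivAt.const_add θ))).mul_const' I |>.congr_fderiv (by
      ext <;> simp [mul_comm])
  have h2 : HasFDerivAt (fun y ↦ u (y + c)) (fderiv ℝ u (x + c)) x :=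
    (hasFDerivAt_comp_add_right c).2 (hu (x + c)).hasFDerivAt
  have h := (h1.cexp.mul h2).fderiv
  change fderiv ℝ (twist θ L c u) x = _ at h
  rw [h]
  simp
  ring

theorem covD_twist (B : ℝ) (α : Pt) (θ : ℝ) (L : Pt →L[ℝ] ℝ) (c : Pt) {u : Pt → ℂ}
    (hu : Differentiable ℝ u) (v x : Pt) :
    covD B α v (twist θ L c u) x =
      twist θ L c (covD B α v u) x + ((L v + B / 2 * wedge c v : ℝ) : ℂ) * twist θ L c u x := by
  rw [covD, fderiv_twist θ L c hu]
  simp only [twist, covD, wedge_add_left]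
  push_cast
  linear_combination cexp ((θ + L x) * I) * (-(L v * u (x + c)) * I_sq)

theorem contDiff_covD (B : ℝ) (α v : Pt) {u : Pt → ℂ} (hu : ContDiff ℝ (⊤ : ℕ∞) u) :
    ContDiff ℝ (⊤ : ℕ∞) (covD B α v u) := by
  have h : ContDiff ℝ (⊤ : ℕ∞) fun x ↦ fderiv ℝ u x v :=
    (hu.fderiv_right (m := (⊤ : ℕ∞)) (by simp)).clm_apply contDiff_const
  have h' : ContDiff ℝ (⊤ : ℕ∞) fun x ↦ dotp α v + B / 2 * wedge x v := by
    unfold wedge; fun_prop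
  exact (contDiff_const.mul h).sub ((ofRealCLM.contDiff.comp h').mul hu)

theorem covD_add (B : ℝ) (α v : Pt) {f g : Pt → ℂ} (hf : Differentiable ℝ f)
    (hg : Differentiable ℝ g) (a b : ℂ) (x : Pt) :
    covD B α v (fun y ↦ a * f y + b * g y) x = a * covD B α v f x + b * covD B α v g x := by
  have h := (((hf x).hasFDerivAt.const_mul a).add ((hg x).hasFDerivAt.const_mul b)).fderiv
  change fderiv ℝ (fun y ↦ a * f y + b * g y) x = _ at h
  simp only [covD, h]
  simp
  ring

theorem covD_const_mul (B : ℝ) (α v : Pt) {f : Pt → ℂ} (hf : Differentiable ℝ f) (a : ℂ)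
    (x : Pt) : covD B α v (fun y ↦ a * f y) x = a * covD B α v f x := by
  simpa using covD_add B α v hf hf a 0 x

theorem covD_eq_Dop (B : ℝ) (α v : Pt) (u : Pt → ℂ) (x : Pt) :
    covD B α v u x = v.1 * Dop1 α (A0 B) u x + v.2 * Dop2 α (A0 B) u x := by
  have h : fderiv ℝ u x v = v.1 * fderiv ℝ u x (1, 0) + v.2 * fderiv ℝ u x (0, 1) := by
    have : v = v.1 • ((1, 0) : Pt) + v.2 • ((0, 1) : Pt) := by ext <;> simp
    conv_lhs => rw [this]
    simp only [map_add, map_smul, real_smul]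
  simp only [covD, h, Dop1, Dop2, pd1, pd2, A0, dotp, wedge]
  push_cast
  ring

/-- The commutator of two covariant derivatives is the curvature. -/
theorem covD_comm (B : ℝ) (α v w : Pt) {u : Pt → ℂ} (hu : ContDiff ℝ (⊤ : ℕ∞) u) (x : Pt) :
    covD B α v (covD B α w u) x - covD B α w (covD B α v u) x = I * B * wedge v w * u x := by
  have key : ∀ v w : Pt, fderiv ℝ (covD B α w u) x v = -I * fderiv ℝ (fderiv ℝ u) x v w -
      ((B / 2 * wedge v w : ℝ) : ℂ) * u x -
      ((dotp α w + B / 2 * wedge x w : ℝ) : ℂ) * fderiv ℝ u x v := by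
    intro v w
    have h1 : HasFDerivAt (fun y ↦ fderiv ℝ u y w) ((fderiv ℝ (fderiv ℝ u) x).flip w) x := by
      have := ((hu.fderiv_right (m := (⊤ : ℕ∞)) (by simp)).differentiable
        (by simp) x).hasFDerivAt.clm_apply (hasFDerivAt_const w x)
      simpa using this
    have h2 : HasFDerivAt (fun y ↦ ((dotp α w + B / 2 * wedge y w : ℝ) : ℂ))
        (ofRealCLM.comp (-(B / 2) • wedgeCLM w)) x := by
      have h := (((-(B / 2)) • wedgeCLM w).hasFDerivAt (x := x)).const_add (dotp α w)
      have e : (fun y ↦ dotp α w + B / 2 * wedge y w) =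
          fun y ↦ dotp α w + ((-(B / 2)) • wedgeCLM w) y := by
        funext y
        simp [wedge_swap y w]
      rw [← e] at h
      exact ofRealCLM.hasFDerivAt.comp x h
    have h3 := ((h1.const_mul (-I)).sub
      (h2.mul (hu.differentiable (by simp) x).hasFDerivAt)).fderiv
    change fderiv ℝ (covD B α w u) x = _ at h3
    rw [h3]
    simp [wedge_swap v w]
    ring
  have hs : fderiv ℝ (fderiv ℝ u) x v w = fderiv ℝ (fderiv ℝ u) x w v :=
    (hu.contDiffAt.isSymmSndFDerivAt (by simpa using WithTop.coe_le_coe.2 (le_top : (2 : ℕ∞) ≤ ⊤))) v w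
  have e : ∀ (v : Pt) (f : Pt → ℂ), covD B α v f x =
    -I * fderiv ℝ f x v - ((dotp α v + B / 2 * wedge x v : ℝ) : ℂ) * f x := fun _ _ ↦ rfl
  rw [e v (covD B α w u), e w (covD B α v u), key, key, hs, wedge_swap w v, e v u, e w u]
  push_cast
  linear_combination (fderiv ℝ (fderiv ℝ u) x w v - fderiv ℝ (fderiv ℝ u) x w v) * I_sq

/-- The integer vector `m` as a point of the plane. -/
def latticePt (m : ℤ × ℤ) : Pt := ((m.1 : ℝ), (m.2 : ℝ))

theorem memCL_iff {B : ℝ} {u : Pt → ℂ} :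
    MemCL B u ↔ ContDiff ℝ (⊤ : ℕ∞) u ∧
      ∀ m : ℤ × ℤ, twist 0 (-(B / 2) • wedgeCLM (latticePt m)) (latticePt m) u = u := by
  have key : ∀ m : ℤ × ℤ, magTrans B m u = u ↔
      twist 0 (-(B / 2) • wedgeCLM (latticePt m)) (latticePt m) u = u := by
    intro m
    have hadd : ∀ x : Pt, (x + latticePt m).1 - m.1 = x.1 ∧ (x + latticePt m).2 - m.2 = x.2 := by
      intro x; simp [latticePt]
    have hsub : ∀ x : Pt, (x.1 - m.1, x.2 - m.2) + latticePt m = x := by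
      intro x; ext <;> simp [latticePt]
    constructor
    · intro h
      funext x
      have := congrFun h (x + latticePt m)
      simp only [magTrans, (hadd x).1, (hadd x).2] at this
      rw [twist, ← this, ← mul_assoc, ← Complex.exp_add]
      change cexp (_ + I * (B / 2) * (wedge (latticePt m) (x + latticePt m) : ℝ)) * u x = u x
      rw [wedge_add_right, wedge_self]
      simp
      exact (congrArg (· * u x) (Complex.exp_eq_one_iff.2 ⟨0, by push_cast; ring⟩)).trans
        (one_mul _)
    · intro h
      funext x
      have := congrFun h (x.1 - m.1, x.2 - m.2)
      rw [twist, hsub] at this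
      rw [magTrans, ← this, ← mul_assoc, ← Complex.exp_add]
      change cexp (I * (B / 2) * (wedge (latticePt m) x : ℝ) + _) * u x = u x
      have e : wedge (latticePt m) (x.1 - m.1, x.2 - m.2) = wedge (latticePt m) x := by
        simp [wedge, latticePt]; ring
      simp [e]
      exact (congrArg (· * u x) (Complex.exp_eq_one_iff.2 ⟨0, by push_cast; ring⟩)).trans
        (one_mul _)
  simp only [MemCL, key]

theorem MemCL.covD {B : ℝ} {u : Pt → ℂ} (hu : MemCL B u) (α v : Pt) :
    MemCL B (covD B α v u) := by
  obtain ⟨h1, h2⟩ := memCL_iff.1 hu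
  refine memCL_iff.2 ⟨contDiff_covD B α v h1, fun m ↦ funext fun x ↦ ?_⟩
  have := covD_twist B α 0 (-(B / 2) • wedgeCLM (latticePt m)) (latticePt m)
    (h1.differentiable (by simp)) v x
  rw [h2 m] at this
  simpa using this.symm

/-- Parallel transport preserves sections up to a lattice phase. -/
theorem MemCL.twist {B : ℝ} {u : Pt → ℂ} (hu : MemCL B u) (θ s t : ℝ) (e : Pt)
    (h : ∀ m : ℤ × ℤ, cexp ((B / 2 * (t - s) * wedge e (latticePt m) : ℝ) * I) = 1) :
    MemCL B (twist θ ((B / 2 * t) • wedgeCLM e) (s • e) u) := by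
  obtain ⟨h1, h2⟩ := memCL_iff.1 hu
  refine memCL_iff.2 ⟨contDiff_twist _ _ _ h1, fun m ↦ funext fun x ↦ ?_⟩
  have hx := congrFun (h2 m) (x + s • e)
  simp only [_root_.twist] at hx ⊢
  rw [← hx, add_right_comm x, ← mul_assoc, ← mul_assoc, ← Complex.exp_add, ← Complex.exp_add]
  congr 1
  symm
  rw [← mul_one (cexp (_ + _)), ← h m, ← Complex.exp_add]
  congr 1
  simp [wedge, latticePt]
  ring

theorem MemCL.continuous {B : ℝ} {u : Pt → ℂ} (hu : MemCL B u) : Continuous u := hu.1.continuous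

theorem MemCL.differentiable {B : ℝ} {u : Pt → ℂ} (hu : MemCL B u) : Differentiable ℝ u :=
  hu.1.differentiable (by simp)

/-- The pointwise Hermitian product of two sections is periodic. -/
theorem MemCL.isPeriodic_mul_conj {B : ℝ} {u w : Pt → ℂ} (hu : MemCL B u) (hw : MemCL B w) :
    IsPeriodic fun x ↦ u x * conj (w x) := by
  intro m x
  have e1 := congrFun ((memCL_iff.1 hu).2 m) x
  have e2 := congrFun ((memCL_iff.1 hw).2 m) x
  simp only [_root_.twist] at e1 e2
  change u (x + latticePt m) * conj (w (x + latticePt m)) = u x * conj (w x)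
  rw [← e1, ← e2, map_mul, mul_mul_mul_comm, Complex.mul_conj, Complex.normSq_eq_norm_sq,
    norm_exp_ofReal_mul_I]
  simp

theorem MemCL.isPeriodic_norm_sq {B : ℝ} {u : Pt → ℂ} (hu : MemCL B u) :
    IsPeriodic fun x ↦ ‖u x‖ ^ 2 := by
  intro m x
  have := hu.isPeriodic_mul_conj hu m x
  simp only [Complex.mul_conj, Complex.normSq_eq_norm_sq] at this
  exact_mod_cast this

/-- The `L²` pairing over the fundamental domain. -/
noncomputable def pairing (u w : Pt → ℂ) : ℂ := ∫ x in fund, u x * conj (w x)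

theorem pairing_add_left {f g h : Pt → ℂ} (hf : Continuous f) (hg : Continuous g)
    (hh : Continuous h) : pairing (fun x ↦ f x + g x) h = pairing f h + pairing g h := by
  unfold pairing
  rw [← integral_add (integrableOn_fund (by fun_prop)) (integrableOn_fund (by fun_prop))]
  simp only [add_mul]

theorem pairing_add_right {f g h : Pt → ℂ} (hf : Continuous f) (hg : Continuous g)
    (hh : Continuous h) : pairing h (fun x ↦ f x + g x) = pairing h f + pairing h g := by
  unfold pairing
  rw [← integral_add (integrableOn_fund (by fun_prop)) (integrableOn_fund (by fun_prop))]
  simp only [map_add, mul_add]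

theorem pairing_const_mul_left (c : ℂ) (f g : Pt → ℂ) :
    pairing (fun x ↦ c * f x) g = c * pairing f g := by
  unfold pairing
  rw [← integral_const_mul]
  simp only [mul_assoc]

theorem pairing_const_mul_right (c : ℂ) (f g : Pt → ℂ) :
    pairing f (fun x ↦ c * g x) = conj c * pairing f g := by
  unfold pairing
  rw [← integral_const_mul]
  simp only [map_mul, mul_left_comm]

theorem pairing_self (u : Pt → ℂ) : pairing u u = ((∫ x in fund, ‖u x‖ ^ 2 : ℝ) : ℂ) := by
  rw [pairing, ← integral_complex_ofReal]
  simp only [Complex.mul_conj, Complex.normSq_eq_norm_sq]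

/-- Covariant derivatives are symmetric. -/
theorem pairing_covD {B : ℝ} (α v : Pt) {u w : Pt → ℂ} (hu : MemCL B u) (hw : MemCL B w) :
    pairing (covD B α v u) w = pairing u (covD B α v w) := by
  have hwd := hw.differentiable
  have hconj : ∀ x, HasFDerivAt (fun y ↦ conj (w y))
      ((conjCLE : ℂ →L[ℝ] ℂ).comp (fderiv ℝ w x)) x := fun x ↦
    conjCLE.hasFDerivAt.comp x (hwd x).hasFDerivAt
  have hsm : ContDiff ℝ (⊤ : ℕ∞) fun x ↦ u x * conj (w x) :=
    hu.1.mul (conjCLE.contDiff.comp hw.1)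
  have h0 := (hu.isPeriodic_mul_conj hw).setIntegral_fderiv_eq_zero (hsm.of_le (by
    exact_mod_cast le_top)) v
  have hc : ∀ {f g : Pt → ℂ}, MemCL B f → MemCL B g →
      IntegrableOn (fun x ↦ f x * conj (g x)) fund := fun hf hg ↦ integrableOn_fund (by
    have := hf.continuous; have := hg.continuous; fun_prop)
  rw [← sub_eq_zero, pairing, pairing, ← integral_sub (hc (hu.covD α v) hw) (hc hu (hw.covD α v)),
    ← mul_zero (-I), ← h0, ← integral_const_mul]
  refine integral_congr_ae (.of_forall fun x ↦ ?_)
  have := ((hu.differentiable x).hasFDerivAt.mul (hconj x)).fderiv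
  change fderiv ℝ (fun y ↦ u y * conj (w y)) x = _ at this
  simp only [this, covD, map_sub, map_mul, map_neg, conj_ofReal, conj_I]
  simp
  ring

theorem norm_pairing_le {f g : Pt → ℂ} (hf : Continuous f) (hg : Continuous g) {l : ℝ}
    (hl : 0 ≤ l) (hf1 : ∫ x in fund, ‖f x‖ ^ 2 ≤ 1) (hg1 : ∫ x in fund, ‖g x‖ ^ 2 ≤ l ^ 2) :
    ‖pairing f g‖ ≤ l := by
  refine le_of_forall_gt_imp_ge_of_dense fun t ht ↦ ?_
  have ht0 : 0 < t := hl.trans_lt ht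
  calc ‖pairing f g‖ ≤ ∫ x in fund, ‖f x * conj (g x)‖ := norm_integral_le_integral_norm _
    _ ≤ ∫ x in fund, (t / 2 * ‖f x‖ ^ 2 + 1 / (2 * t) * ‖g x‖ ^ 2) := by
        refine integral_mono (integrableOn_fund (by fun_prop)) (integrableOn_fund (by fun_prop))
          fun x ↦ ?_
        have : t / 2 * ‖f x‖ ^ 2 + 1 / (2 * t) * ‖g x‖ ^ 2 - ‖f x‖ * ‖g x‖ =
          (t * ‖f x‖ - ‖g x‖) ^ 2 / (2 * t) := by field_simp; ring
        have h2 : 0 ≤ (t * ‖f x‖ - ‖g x‖) ^ 2 / (2 * t) := by positivity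
        simp only [norm_mul, RCLike.norm_conj]
        linarith
    _ = t / 2 * (∫ x in fund, ‖f x‖ ^ 2) + 1 / (2 * t) * ∫ x in fund, ‖g x‖ ^ 2 := by
        rw [integral_add (integrableOn_fund (by fun_prop)) (integrableOn_fund (by fun_prop)),
          integral_const_mul, integral_const_mul]
    _ ≤ t / 2 * 1 + 1 / (2 * t) * t ^ 2 := by
        gcongr
        exact hg1.trans (by gcongr)
    _ = t := by field_simp; ring

/-- Rotation of a vector by a right angle. -/
def rot (e : Pt) : Pt := (-e.2, e.1)

theorem wedge_rot (e : Pt) : wedge e (rot e) = e.1 ^ 2 + e.2 ^ 2 := by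
  simp [wedge, rot]; ring

/-- The magnetic Laplacian in a rotated orthonormal frame. -/
theorem covD_rot_eq_magLap {B : ℝ} (α : Pt) {e : Pt} (he : e.1 ^ 2 + e.2 ^ 2 = 1) {u : Pt → ℂ}
    (hu : MemCL B u) (x : Pt) :
    covD B α e (covD B α e u) x + covD B α (rot e) (covD B α (rot e) u) x =
      magLap α (A0 B) u x := by
  have h1 : Dop1 α (A0 B) u = covD B α (1, 0) u := by
    funext y; simp [covD_eq_Dop]
  have h2 : Dop2 α (A0 B) u = covD B α (0, 1) u := by
    funext y; simp [covD_eq_Dop]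
  have hd1 : Differentiable ℝ (covD B α (1, 0) u) := (hu.covD α _).differentiable
  have hd2 : Differentiable ℝ (covD B α (0, 1) u) := (hu.covD α _).differentiable
  have hv : ∀ v : Pt, covD B α v (covD B α v u) x =
      v.1 * (v.1 * Dop1 α (A0 B) (covD B α (1, 0) u) x +
        v.2 * Dop1 α (A0 B) (covD B α (0, 1) u) x) +
      v.2 * (v.1 * Dop2 α (A0 B) (covD B α (1, 0) u) x +
        v.2 * Dop2 α (A0 B) (covD B α (0, 1) u) x) := by
    intro v
    have e0 : covD B α v u = fun y ↦ v.1 * covD B α (1, 0) u y + v.2 * covD B α (0, 1) u y := by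
      funext y; rw [covD_eq_Dop, h1, h2]
    have a1 := covD_add B α (1, 0) hd1 hd2 v.1 v.2 x
    have a2 := covD_add B α (0, 1) hd1 hd2 v.1 v.2 x
    rw [← e0] at a1 a2
    simp only [covD_eq_Dop B α (1, 0), covD_eq_Dop B α (0, 1)] at a1 a2
    rw [covD_eq_Dop]
    simp only [ofReal_one, ofReal_zero, one_mul, zero_mul, zero_add, add_zero] at a1 a2
    have b1 : (fun y ↦ Dop1 α (A0 B) u y) = covD B α (1, 0) u := h1
    have b2 : (fun y ↦ Dop2 α (A0 B) u y) = covD B α (0, 1) u := h2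
    rw [a1, a2]
  have heC : (e.1 : ℂ) ^ 2 + (e.2 : ℂ) ^ 2 = 1 := by exact_mod_cast he
  rw [hv, hv, magLap, h1, h2]
  simp only [rot]
  push_cast
  linear_combination (Dop1 α (A0 B) (covD B α (1, 0) u) x +
    Dop2 α (A0 B) (covD B α (0, 1) u) x) * heC

/-- Parallel transport along `(r - ρ) e` composed with the multiplication by
`exp (i B ρ e ∧ x)`, written symmetrically. -/
noncomputable def transport (B : ℝ) (α e : Pt) (ρ r : ℝ) (u : Pt → ℂ) : Pt → ℂ :=
  twist (-((r - ρ) * dotp α e)) ((B / 2 * (r + ρ)) • wedgeCLM e) ((r - ρ) • e) u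

section transport

variable {B : ℝ} {α e : Pt} {ρ : ℝ} {u : Pt → ℂ}

theorem MemCL.transport (hu : MemCL B u) (α : Pt) (r : ℝ)
    (hρ : ∀ m : ℤ × ℤ, cexp ((B * ρ * wedge e (latticePt m) : ℝ) * I) = 1) :
    MemCL B (transport B α e ρ r u) := by
  refine hu.twist _ _ _ _ fun m ↦ ?_
  rw [← hρ m]
  congr 3
  ring

theorem covD_transport (hu : MemCL B u) (r : ℝ) (v x : Pt) :
    covD B α v (transport B α e ρ r u) x =
      transport B α e ρ r (covD B α v u) x + (B * r * wedge e v : ℝ) * transport B α e ρ r u x := by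
  rw [transport, covD_twist _ _ _ _ _ hu.differentiable, transport]
  congr 3
  simp [wedge_smul_left]
  ring

theorem covD_self_transport (hu : MemCL B u) (r : ℝ) :
    covD B α e (transport B α e ρ r u) = transport B α e ρ r (covD B α e u) := by
  funext x
  simp [covD_transport hu, wedge_self]

theorem transport_eigen (he : e.1 ^ 2 + e.2 ^ 2 = 1) (hu : MemCL B u) {l : ℝ}
    (hl : ∀ x, magLap α (A0 B) u x = ((l ^ 2 : ℝ) : ℂ) * u x) (r : ℝ)
    (hG : MemCL B (transport B α e ρ r u)) (x : Pt) :
    covD B α e (covD B α e (transport B α e ρ r u)) x +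
      covD B α (rot e) (covD B α (rot e) (transport B α e ρ r u)) x =
    ((l ^ 2 - (B * r) ^ 2 : ℝ) : ℂ) * transport B α e ρ r u x +
      ((2 * (B * r) : ℝ) : ℂ) * covD B α (rot e) (transport B α e ρ r u) x := by
  have hP : ∀ w, MemCL B w → ∀ y, transport B α e ρ r (covD B α (rot e) w) y =
      1 * covD B α (rot e) (transport B α e ρ r w) y +
        (-(B * r) : ℝ) * transport B α e ρ r w y := by
    intro w hw y
    rw [covD_transport hw, wedge_rot, he]
    push_cast; ring
  have e1 : transport B α e ρ r (covD B α (rot e) (covD B α (rot e) u)) x =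
      covD B α (rot e) (covD B α (rot e) (transport B α e ρ r u)) x -
      2 * (B * r) * covD B α (rot e) (transport B α e ρ r u) x +
      (B * r) ^ 2 * transport B α e ρ r u x := by
    rw [hP _ (hu.covD α _), funext (hP _ hu),
      covD_add _ _ _ (hG.covD α _).differentiable hG.differentiable]
    push_cast; ring
  have e2 : transport B α e ρ r (covD B α e (covD B α e u)) x +
      transport B α e ρ r (covD B α (rot e) (covD B α (rot e) u)) x =
      ((l ^ 2 : ℝ) : ℂ) * transport B α e ρ r u x := by
    simp only [transport, twist]
    rw [← mul_add, covD_rot_eq_magLap α he hu, hl]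
    ring
  rw [covD_self_transport hu, covD_self_transport (hu.covD α _)]
  rw [e1] at e2
  push_cast at e2 ⊢
  linear_combination e2

theorem hasDerivAt_transport (hu : MemCL B u) (x : Pt) (r : ℝ) :
    HasDerivAt (fun s ↦ transport B α e ρ s u x)
      (I * transport B α e ρ r (covD B α e u) x) r := by
  have h1 : HasDerivAt (fun s : ℝ ↦ x + (s - ρ) • e) e r := by
    simpa using (((hasDerivAt_id r).sub_const ρ).smul_const e).const_add x
  have h2 := (hu.differentiable (x + (r - ρ) • e)).hasFDerivAt.comp_hasDerivAt r h1
  have h3 : HasDerivAt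
      (fun s : ℝ ↦ -((s - ρ) * dotp α e) + ((B / 2 * (s + ρ)) • wedgeCLM e) x)
      (-dotp α e + B / 2 * wedge e x) r := by
    have a := (((hasDerivAt_id r).sub_const ρ).mul_const (dotp α e)).neg
    have b := (((hasDerivAt_id r).add_const ρ).const_mul (B / 2)).mul_const (wedge e x)
    have h := a.add b
    convert! h using 1
    simp
  have h4 := (h3.ofReal_comp.mul_const I).cexp.mul h2
  refine h4.congr_deriv ?_
  simp only [transport, twist, covD, Function.comp, wedge_add_left, wedge_smul_left, wedge_self,
    mul_zero, add_zero, wedge_swap x e]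
  push_cast
  linear_combination (cexp ((-((↑r - ↑ρ) * ↑(dotp α e)) +
    ↑(((B / 2 * (r + ρ)) • wedgeCLM e) x)) * I) * (fderiv ℝ u (x + (r - ρ) • e)) e) * I_sq

theorem continuous_transport (hu : Continuous u) :
    Continuous fun p : ℝ × Pt ↦ transport B α e ρ p.1 u p.2 := by
  simp only [transport, twist, _root_.smul_apply, smul_eq_mul]
  have h : Continuous fun p : ℝ × Pt ↦
      -((p.1 - ρ) * dotp α e) + B / 2 * (p.1 + ρ) * (wedgeCLM e) p.2 := by fun_prop
  have h' := (continuous_ofReal.comp h).mul_const I |>.cexp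
  exact h'.mul (by fun_prop)

theorem hasDerivAt_pairing_transport (hu : MemCL B u) {F : Pt → ℂ} (hF : MemCL B F)
    (hρ : ∀ m : ℤ × ℤ, cexp ((B * ρ * wedge e (latticePt m) : ℝ) * I) = 1) (r : ℝ) :
    HasDerivAt (fun s ↦ pairing (transport B α e ρ s u) F)
      (I * pairing (transport B α e ρ r u) (covD B α e F)) r := by
  have hFc := hF.continuous
  have h := hasDerivAt_setIntegral_fund
    (K := fun s x ↦ transport B α e ρ s u x * conj (F x))
    (K' := fun s x ↦ I * transport B α e ρ s (covD B α e u) x * conj (F x))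
    (fun s ↦ by have := (hu.transport α s hρ).continuous; fun_prop)
    ((continuous_const.mul (continuous_transport (hu.covD α e).continuous)).mul (by fun_prop))
    (fun s x ↦ (hasDerivAt_transport hu x s).mul_const _) r
  refine h.congr_deriv ?_
  rw [← pairing_covD α e (hu.transport α r hρ) hF, covD_self_transport hu, ← pairing_const_mul_left]
  rfl

theorem integral_norm_sq_transport (hu : MemCL B u) (r : ℝ) :
    ∫ x in fund, ‖transport B α e ρ r u x‖ ^ 2 = ∫ x in fund, ‖u x‖ ^ 2 := by
  have := hu.continuous
  simp only [transport, norm_twist]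
  exact hu.isPeriodic_norm_sq.setIntegral_fund_add (by fun_prop) _

theorem pairing_transport_eigen (he : e.1 ^ 2 + e.2 ^ 2 = 1) (hu : MemCL B u) {l : ℝ}
    (hl : ∀ x, magLap α (A0 B) u x = ((l ^ 2 : ℝ) : ℂ) * u x)
    (hρ : ∀ m : ℤ × ℤ, cexp ((B * ρ * wedge e (latticePt m) : ℝ) * I) = 1) (r : ℝ)
    {F : Pt → ℂ} (hF : MemCL B F) :
    pairing (transport B α e ρ r u) (covD B α e (covD B α e F)) +
      pairing (transport B α e ρ r u) (covD B α (rot e) (covD B α (rot e) F)) =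
    ((l ^ 2 - (B * r) ^ 2 : ℝ) : ℂ) * pairing (transport B α e ρ r u) F +
      ((2 * (B * r) : ℝ) : ℂ) * pairing (transport B α e ρ r u) (covD B α (rot e) F) := by
  have hG := hu.transport α r hρ
  have hGP := hG.covD α (rot e)
  rw [← pairing_covD α e hG (hF.covD α e), ← pairing_covD α e (hG.covD α e) hF,
    ← pairing_covD α (rot e) hG (hF.covD α _), ← pairing_covD α (rot e) hGP hF,
    ← pairing_covD α (rot e) hG hF,
    ← pairing_add_left ((hG.covD α e).covD α e).continuous (hGP.covD α _).continuous hF.continuous,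
    ← pairing_const_mul_left, ← pairing_const_mul_left,
    ← pairing_add_left (by have := hG.continuous; fun_prop) (by have := hGP.continuous; fun_prop)
      hF.continuous]
  congr 1
  exact funext (transport_eigen he hu hl r hG)

/-- The radial equation for matrix elements of parallel transport between eigenfunctions. -/
theorem pairing_transport_ode (he : e.1 ^ 2 + e.2 ^ 2 = 1) (hB : B ≠ 0) (hu : MemCL B u) {l : ℝ}
    (hl : ∀ x, magLap α (A0 B) u x = ((l ^ 2 : ℝ) : ℂ) * u x)
    (hρ : ∀ m : ℤ × ℤ, cexp ((B * ρ * wedge e (latticePt m) : ℝ) * I) = 1) {r : ℝ} (hr : r ≠ 0) :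
    I * (I * pairing (transport B α e ρ r u) (covD B α e (covD B α e u))) =
      -((l ^ 2 - B ^ 2 * r ^ 2 / 4 : ℝ) : ℂ) * pairing (transport B α e ρ r u) u -
        I * pairing (transport B α e ρ r u) (covD B α e u) / r := by
  have h1 := pairing_transport_eigen he hu hl hρ r hu
  have h2 := pairing_transport_eigen he hu hl hρ r (hu.covD α (rot e))
  have hQ := hu.covD α e
  have hP := hu.covD α (rot e)
  have hcomm : ∀ w, MemCL B w → ∀ x, covD B α e (covD B α (rot e) w) x =
      1 * covD B α (rot e) (covD B α e w) x + (I * B) * w x := by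
    intro w hw x
    have := covD_comm B α e (rot e) hw.1 x
    rw [wedge_rot, he] at this
    push_cast at this
    linear_combination this
  have hsum : ∀ x, 1 * covD B α e (covD B α e u) x +
      1 * covD B α (rot e) (covD B α (rot e) u) x = ((l ^ 2 : ℝ) : ℂ) * u x := by
    intro x; rw [one_mul, one_mul, covD_rot_eq_magLap α he hu, hl]
  have hsum' : (fun x ↦ covD B α e (covD B α e u) x +
      covD B α (rot e) (covD B α (rot e) u) x) = fun x ↦ ((l ^ 2 : ℝ) : ℂ) * u x := by
    simpa using funext hsum
  have hG := (hu.transport α r hρ).continuous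
  have h3 : pairing (transport B α e ρ r u) (covD B α e (covD B α e u)) +
      pairing (transport B α e ρ r u) (covD B α (rot e) (covD B α (rot e) u)) =
      ((l ^ 2 : ℝ) : ℂ) * pairing (transport B α e ρ r u) u := by
    rw [← pairing_add_right (hQ.covD α e).continuous (hP.covD α _).continuous hG, hsum',
      pairing_const_mul_right, conj_ofReal]
  have hfun : (fun x ↦ covD B α e (covD B α e (covD B α (rot e) u)) x +
      covD B α (rot e) (covD B α (rot e) (covD B α (rot e) u)) x) =
      fun x ↦ ((l ^ 2 : ℝ) : ℂ) * covD B α (rot e) u x + (2 * I * B) * covD B α e u x := by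
    funext x
    have a1 : covD B α e (covD B α e (covD B α (rot e) u)) x =
        covD B α (rot e) (covD B α e (covD B α e u)) x + 2 * I * B * covD B α e u x := by
      rw [funext (hcomm u hu), covD_add _ _ _ (hQ.covD α _).differentiable hu.differentiable,
        hcomm _ hQ]
      ring
    have a2 := covD_add B α (rot e) (hQ.covD α e).differentiable (hP.covD α (rot e)).differentiable
      1 1 x
    rw [funext hsum, covD_const_mul _ _ _ hu.differentiable] at a2
    linear_combination a1 - a2
  have h4 : pairing (transport B α e ρ r u) (covD B α e (covD B α e (covD B α (rot e) u))) +
      pairing (transport B α e ρ r u)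
        (covD B α (rot e) (covD B α (rot e) (covD B α (rot e) u))) =
      ((l ^ 2 : ℝ) : ℂ) * pairing (transport B α e ρ r u) (covD B α (rot e) u) +
      (-(2 * I * B)) * pairing (transport B α e ρ r u) (covD B α e u) := by
    rw [← pairing_add_right ((hP.covD α e).covD α e).continuous
      ((hP.covD α _).covD α _).continuous hG, hfun,
      pairing_add_right (by have := hP.continuous; fun_prop) (by have := hQ.continuous; fun_prop)
      hG, pairing_const_mul_right, pairing_const_mul_right, conj_ofReal]
    simp [map_ofNat]
  set f := pairing (transport B α e ρ r u) u
  set p := pairing (transport B α e ρ r u) (covD B α (rot e) u)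
  set q := pairing (transport B α e ρ r u) (covD B α e u)
  set g := pairing (transport B α e ρ r u) (covD B α (rot e) (covD B α (rot e) u))
  rw [h3] at h1
  rw [h4] at h2
  have hB' : (B : ℂ) ≠ 0 := by exact_mod_cast hB
  have hr' : (r : ℂ) ≠ 0 := by exact_mod_cast hr
  push_cast at h1 h2 h3 ⊢
  have hp : 2 * p = B * r * f := by
    refine mul_left_cancel₀ (mul_ne_zero hB' hr') ?_
    linear_combination -h1
  have hg : 4 * r * g = B ^ 2 * r ^ 3 * f - 4 * I * q := by
    refine mul_left_cancel₀ hB' ?_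
    linear_combination -2 * h2 + B ^ 2 * r ^ 2 * hp
  field_simp
  linear_combination 4 * r * (pairing (transport B α e ρ r u) (covD B α e (covD B α e u))) * I_sq -
    4 * r * h3 + hg

end transport

section bounds

variable {B : ℝ} {α e : Pt} {ρ : ℝ} {u : Pt → ℂ}

theorem integral_norm_sq_covD_le (he : e.1 ^ 2 + e.2 ^ 2 = 1) (hu : MemCL B u) {l : ℝ}
    (hl : ∀ x, magLap α (A0 B) u x = ((l ^ 2 : ℝ) : ℂ) * u x)
    (h1 : ∫ x in fund, ‖u x‖ ^ 2 = 1) : ∫ x in fund, ‖covD B α e u x‖ ^ 2 ≤ l ^ 2 := by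
  have hQ := hu.covD α e
  have hP := hu.covD α (rot e)
  have hsum : (fun x ↦ covD B α e (covD B α e u) x +
      covD B α (rot e) (covD B α (rot e) u) x) = fun x ↦ ((l ^ 2 : ℝ) : ℂ) * u x :=
    funext fun x ↦ by rw [covD_rot_eq_magLap α he hu, hl]
  have h := pairing_const_mul_left ((l ^ 2 : ℝ) : ℂ) u u
  rw [← hsum, pairing_add_left (hQ.covD α e).continuous (hP.covD α _).continuous hu.continuous,
    pairing_covD α _ hQ hu, pairing_covD α _ hP hu, pairing_self, pairing_self, pairing_self,
    h1, ofReal_one, mul_one] at h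
  have h' : (∫ x in fund, ‖covD B α e u x‖ ^ 2) + ∫ x in fund, ‖covD B α (rot e) u x‖ ^ 2 = l ^ 2 := by
    exact_mod_cast h
  have h0 : 0 ≤ ∫ x in fund, ‖covD B α (rot e) u x‖ ^ 2 := integral_nonneg fun x ↦ by positivity
  linarith

/-- Decay of the matrix element of the parallel transport at the lattice radius `ρ`. -/
theorem norm_pairing_transport_sq_le (he : e.1 ^ 2 + e.2 ^ 2 = 1) (hB : 0 < B) (hu : MemCL B u)
    {l : ℝ} (hl0 : 0 ≤ l) (hl : ∀ x, magLap α (A0 B) u x = ((l ^ 2 : ℝ) : ℂ) * u x)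
    (h1 : ∫ x in fund, ‖u x‖ ^ 2 = 1)
    (hρ : ∀ m : ℤ × ℤ, cexp ((B * ρ * wedge e (latticePt m) : ℝ) * I) = 1) (hρ0 : 0 < ρ) :
    ‖pairing (transport B α e ρ ρ u) u‖ ^ 2 * (1 + l) ≤ 1 + 7 / ρ + B * ρ := by
  have hG : ∀ r, Continuous (transport B α e ρ r u) := fun r ↦ (hu.transport α r hρ).continuous
  have hG1 : ∀ r, ∫ x in fund, ‖transport B α e ρ r u x‖ ^ 2 ≤ 1 := fun r ↦
    (integral_norm_sq_transport hu r).trans h1 |>.le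
  have hf : ∀ r, ‖pairing (transport B α e ρ r u) u‖ ≤ 1 := fun r ↦
    norm_pairing_le (hG r) hu.continuous zero_le_one (hG1 r) (by simp [h1])
  have hf' : ∀ r, ‖I * pairing (transport B α e ρ r u) (covD B α e u)‖ ≤ l := fun r ↦ by
    rw [norm_mul, norm_I, one_mul]
    exact norm_pairing_le (hG r) (hu.covD α e).continuous hl0 (hG1 r)
      (integral_norm_sq_covD_le he hu hl h1)
  obtain ⟨c, hc, hcf⟩ : ∃ c : ℂ, ‖c‖ = 1 ∧ c * pairing (transport B α e ρ ρ u) u =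
      ‖pairing (transport B α e ρ ρ u) u‖ := by
    obtain h | h := eq_or_ne (pairing (transport B α e ρ ρ u) u) 0
    · exact ⟨1, by simp, by simp [h]⟩
    · refine ⟨‖pairing (transport B α e ρ ρ u) u‖ / pairing (transport B α e ρ ρ u) u, ?_,
        div_mul_cancel₀ _ h⟩
      rw [norm_div, norm_real, norm_norm, div_self (norm_ne_zero_iff.2 h)]
  have hre : ∀ {f : ℝ → ℂ} {f' : ℂ} {r : ℝ}, HasDerivAt f f' r →
      HasDerivAt (fun s ↦ (c * f s).re) (c * f').re r := fun h ↦
    reCLM.hasFDerivAt.comp_hasDerivAt _ (h.const_mul c)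
  have hle : ∀ {z : ℂ} {t : ℝ}, ‖z‖ ≤ t → |(c * z).re| ≤ t := fun {z t} h ↦
    (abs_re_le_norm _).trans (by rwa [norm_mul, hc, one_mul])
  set F := ‖pairing (transport B α e ρ ρ u) u‖
  have hF0 : 0 ≤ F := norm_nonneg _
  have hF1 : F ^ 2 ≤ 1 := pow_le_one₀ hF0 (hf ρ)
  by_cases hcase : B ^ 2 * ρ ^ 2 ≤ 2 * l ^ 2
  · have key := radial_oscillator_bound hl0
      (g := fun r ↦ (c * pairing (transport B α e ρ r u) u).re)
      (h := fun r ↦ (c * (I * pairing (transport B α e ρ r u) (covD B α e u))).re)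
      (b := B) (fun r _ ↦ hre (hasDerivAt_pairing_transport hu hu hρ r))
      (fun r hr ↦ by
        refine (hre ((hasDerivAt_pairing_transport hu (hu.covD α e) hρ r).const_mul I)).congr_deriv ?_
        rw [pairing_transport_ode he hB.ne' hu hl hρ hr.ne', mul_sub, sub_re, mul_left_comm,
          ← ofReal_neg, re_ofReal_mul, ← mul_div_assoc, div_ofReal_re])
      (fun r ↦ hle (hf r)) (fun r ↦ hle (hf' r)) hρ0 hcase
    simp only [hcf, ofReal_re] at key
    have : l * F ^ 2 ≤ 7 / ρ := by
      rw [le_div_iff₀ hρ0]; linarith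
    have : 0 ≤ B * ρ := by positivity
    linarith
  · have h2 : l ≤ B * ρ := by
      refine (sq_le_sq₀ hl0 (by positivity)).1 ?_
      nlinarith
    have : 0 ≤ 7 / ρ := by positivity
    nlinarith

end bounds

/-- The character `exp (2πi n·x)` of the torus. -/
noncomputable def planeChar (n : ℤ × ℤ) (x : Pt) : ℂ :=
  cexp ((2 * π * (n.1 * x.1 + n.2 * x.2) : ℝ) * I)

theorem norm_planeChar (n : ℤ × ℤ) (x : Pt) : ‖planeChar n x‖ = 1 :=
  norm_exp_ofReal_mul_I _

theorem contDiff_planeChar (n : ℤ × ℤ) {k : WithTop ℕ∞} : ContDiff ℝ k (planeChar n) :=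
  ((ofRealCLM.contDiff.comp (by fun_prop :
    ContDiff ℝ k fun x : Pt ↦ 2 * π * (n.1 * x.1 + n.2 * x.2))).mul contDiff_const).cexp

theorem planeChar_latticePt (n m : ℤ × ℤ) : planeChar n (latticePt m) = 1 :=
  exp_eq_one_iff.2 ⟨n.1 * m.1 + n.2 * m.2, by simp [latticePt]; ring⟩

theorem planeChar_add (n : ℤ × ℤ) (x y : Pt) :
    planeChar n (x + y) = planeChar n x * planeChar n y := by
  rw [planeChar, planeChar, planeChar, ← Complex.exp_add]
  congr 1
  simp
  ring

theorem isPeriodic_planeChar (n : ℤ × ℤ) : IsPeriodic (planeChar n) := fun m x ↦ by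
  change planeChar n (x + latticePt m) = _
  rw [planeChar_add, planeChar_latticePt, mul_one]

theorem norm_integral_planeChar_mul_le {B : ℝ} {α : Pt} {u : Pt → ℂ} (hB : 0 < B) (hu : MemCL B u)
    {l : ℝ} (hl0 : 0 ≤ l) (hl : ∀ x, magLap α (A0 B) u x = ((l ^ 2 : ℝ) : ℂ) * u x)
    (h1 : ∫ x in fund, ‖u x‖ ^ 2 = 1) {n : ℤ × ℤ} (hn : n ≠ 0) :
    ‖∫ x in fund, planeChar n x * ((‖u x‖ ^ 2 : ℝ) : ℂ)‖ ≤
      √(8 + 2 * B) * ((1 + |(n.1 : ℝ)|) * (1 + |(n.2 : ℝ)|)) * (1 + l) ^ (-(1 / 2) : ℝ) := by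
  set N : ℝ := √((n.1 : ℝ) ^ 2 + (n.2 : ℝ) ^ 2) with hN
  have hN1 : 1 ≤ N := by
    have : (1 : ℤ) ≤ n.1 ^ 2 + n.2 ^ 2 := by
      by_contra! h
      refine hn (Prod.ext ?_ ?_) <;> simp <;> nlinarith [sq_nonneg n.1, sq_nonneg n.2]
    rw [hN, Real.one_le_sqrt]
    exact_mod_cast this
  have hNsq : N ^ 2 = (n.1 : ℝ) ^ 2 + (n.2 : ℝ) ^ 2 := Real.sq_sqrt (by positivity)
  have hN0 : N ≠ 0 := by positivity
  set ρ : ℝ := 2 * π * N / B with hρdef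
  have hρ0 : 0 < ρ := by have := Real.pi_pos; positivity
  set e : Pt := (n.2 / N, -n.1 / N) with hedef
  have he : e.1 ^ 2 + e.2 ^ 2 = 1 := by
    simp only [hedef]; field_simp; linarith
  have hph : ∀ x, B * ρ * wedge e x = 2 * π * (n.1 * x.1 + n.2 * x.2) := fun x ↦ by
    simp only [hedef, hρdef, wedge]; field_simp; ring
  have hρ : ∀ m : ℤ × ℤ, cexp ((B * ρ * wedge e (latticePt m) : ℝ) * I) = 1 := fun m ↦ by
    rw [hph]; exact planeChar_latticePt n m
  have key := norm_pairing_transport_sq_le he hB hu hl0 hl h1 hρ hρ0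
  have hpair : pairing (transport B α e ρ ρ u) u =
      ∫ x in fund, planeChar n x * ((‖u x‖ ^ 2 : ℝ) : ℂ) := by
    refine integral_congr_ae (.of_forall fun x ↦ ?_)
    have hx : ((B / 2 * (ρ + ρ)) • wedgeCLM e) x = 2 * π * (n.1 * x.1 + n.2 * x.2) := by
      rw [← hph x, _root_.smul_apply, smul_eq_mul, wedgeCLM_apply]; ring
    simp only [transport, twist, hx, sub_self, zero_mul, neg_zero, zero_add, zero_smul, add_zero,
      mul_assoc, Complex.mul_conj, Complex.normSq_eq_norm_sq]
    rw [planeChar]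
    simp only [mul_assoc]
  rw [hpair] at key
  set F := ‖∫ x in fund, planeChar n x * ((‖u x‖ ^ 2 : ℝ) : ℂ)‖
  set M := (1 + |(n.1 : ℝ)|) * (1 + |(n.2 : ℝ)|) with hM
  have hM0 : 0 ≤ M := by positivity
  have hπ := Real.pi_gt_three
  have hπ' := Real.pi_lt_d2
  have hNM : 1 + 7 * N ≤ 8 * M ^ 2 := by
    have h3 : N ≤ |(n.1 : ℝ)| + |(n.2 : ℝ)| := by
      refine Real.sqrt_le_iff.2 ⟨by positivity, ?_⟩
      nlinarith [abs_nonneg (n.1 : ℝ), abs_nonneg (n.2 : ℝ), sq_abs (n.1 : ℝ), sq_abs (n.2 : ℝ)]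
    have h4 : 1 + N ≤ M := by nlinarith [abs_nonneg (n.1 : ℝ), abs_nonneg (n.2 : ℝ)]
    nlinarith
  have hM1 : 1 ≤ M := by nlinarith [abs_nonneg (n.1 : ℝ), abs_nonneg (n.2 : ℝ)]
  have hbound : F ^ 2 * (1 + l) ≤ (8 + 2 * B) * M ^ 2 := by
    have h5 : 7 / ρ ≤ 2 * B := by
      rw [div_le_iff₀ hρ0, hρdef]
      field_simp
      nlinarith
    have h6 : B * ρ ≤ 7 * N := by
      rw [hρdef]; field_simp; nlinarith
    nlinarith [mul_nonneg hB.le (sub_nonneg.2 (one_le_pow₀ hM1 : 1 ≤ M ^ 2))]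
  have hl1 : 0 < 1 + l := by linarith
  rw [Real.rpow_neg hl1.le, ← Real.sqrt_eq_rpow, ← div_eq_mul_inv,
    le_div_iff₀ (Real.sqrt_pos.2 hl1)]
  refine (sq_le_sq₀ (by positivity) (by positivity)).1 ?_
  rwa [mul_pow, mul_pow, Real.sq_sqrt hl1.le, Real.sq_sqrt (by positivity)]

/-- The Fourier coefficient of a periodic function of the plane. -/
noncomputable def planeCoeff (a : Pt → ℂ) (n : ℤ × ℤ) : ℂ := ∫ x in fund, planeChar (-n) x * a x

theorem fderiv_planeChar (n : ℤ × ℤ) (x v : Pt) :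
    fderiv ℝ (planeChar n) x v =
      (2 * π * (n.1 * v.1 + n.2 * v.2) : ℝ) * I * planeChar n x := by
  have h1 : HasFDerivAt (fun y : Pt ↦ (2 * π) * ((n.1 : ℝ) * y.1 + n.2 * y.2))
      ((2 * π) • ((n.1 : ℝ) • ContinuousLinearMap.fst ℝ ℝ ℝ +
        (n.2 : ℝ) • ContinuousLinearMap.snd ℝ ℝ ℝ)) x :=
    ((hasFDerivAt_fst.const_mul _).add (hasFDerivAt_snd.const_mul _)).const_mul _
  have h2 := (((ofRealCLM.hasFDerivAt).comp x h1).mul_const' I).cexp.fderiv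
  change fderiv ℝ (planeChar n) x = _ at h2
  rw [h2, planeChar]
  simp
  ring

theorem IsPeriodic.fderiv_apply {a : Pt → ℂ} (ha : IsPeriodic a) (v : Pt) :
    IsPeriodic fun x ↦ fderiv ℝ a x v := fun m x ↦ by
  have : (fun y ↦ a (y + latticePt m)) = a := funext fun y ↦ ha m y
  change fderiv ℝ a (x + latticePt m) v = _
  rw [← fderiv_comp_add_right, this]

theorem planeCoeff_fderiv {a : Pt → ℂ} (ha : ContDiff ℝ 1 a) (hp : IsPeriodic a) (v : Pt)
    (n : ℤ × ℤ) : planeCoeff (fun x ↦ fderiv ℝ a x v) n =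
      (2 * π * (n.1 * v.1 + n.2 * v.2) : ℝ) * I * planeCoeff a n := by
  have hχ : ContDiff ℝ 1 (planeChar (-n)) := contDiff_planeChar _
  have hper : IsPeriodic fun x ↦ planeChar (-n) x * a x := fun m x ↦
    congrArg₂ (· * ·) (isPeriodic_planeChar _ m x) (hp m x)
  have h0 := hper.setIntegral_fderiv_eq_zero (hχ.mul ha) v
  have hχc := hχ.continuous
  have hac := ha.continuous
  have had := ha.continuous_fderiv one_ne_zero
  rw [planeCoeff, planeCoeff, ← integral_const_mul, ← sub_eq_zero,
    ← integral_sub (integrableOn_fund (by fun_prop)) (integrableOn_fund (by fun_prop)), ← h0]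
  refine integral_congr_ae (.of_forall fun x ↦ ?_)
  have := ((hχ.differentiable one_ne_zero x).hasFDerivAt.mul
    (ha.differentiable one_ne_zero x).hasFDerivAt).fderiv
  change fderiv ℝ (fun y ↦ planeChar (-n) y * a y) x = _ at this
  simp only [this, _root_.add_apply, _root_.smul_apply, smul_eq_mul, fderiv_planeChar]
  simp
  ring

/-- `M` bounds all derivatives of order at most `N` on the fundamental domain. -/
def DerivBound (N : ℕ) (a : Pt → ℂ) (M : ℝ) : Prop :=
  ∀ k ≤ N, ∀ x ∈ fund, ‖iteratedFDeriv ℝ k a x‖ ≤ M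

theorem DerivBound.fderiv_apply {N : ℕ} {a : Pt → ℂ} {M : ℝ} (h : DerivBound (N + 1) a M)
    (ha : ContDiff ℝ (⊤ : ℕ∞) a) {v : Pt} (hv : ‖v‖ ≤ 1) :
    DerivBound N (fun x ↦ fderiv ℝ a x v) M := fun k hk x hx ↦ by
  have hd : ContDiff ℝ k (fderiv ℝ a) := ha.fderiv_right (by exact_mod_cast le_top)
  have h1 := (ContinuousLinearMap.apply ℝ ℂ v).norm_iteratedFDeriv_comp_left hd.contDiffAt le_rfl
    (x := x)
  refine h1.trans ?_
  rw [norm_iteratedFDeriv_fderiv]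
  have h2 : ‖ContinuousLinearMap.apply ℝ ℂ v‖ ≤ 1 :=
    ContinuousLinearMap.opNorm_le_bound _ zero_le_one fun L ↦ by
      simpa using (L.le_opNorm v).trans (mul_le_mul_of_nonneg_left hv (norm_nonneg _)) |>.trans
        (by simp)
  exact (mul_le_of_le_one_left (norm_nonneg _) h2).trans (h (k + 1) (by lia) x hx)

theorem DerivBound.norm_planeCoeff_le {N : ℕ} {a : Pt → ℂ} {M : ℝ} (h : DerivBound N a M)
    (n : ℤ × ℤ) : ‖planeCoeff a n‖ ≤ M := by
  have := norm_setIntegral_le_of_norm_le_const (μ := volume) (s := fund) (C := M)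
    isCompact_fund.measure_lt_top (f := fun x ↦ planeChar (-n) x * a x) (fun x hx ↦ by
      rw [norm_mul, norm_planeChar, one_mul]
      simpa using h 0 (Nat.zero_le _) x hx)
  rwa [volume_real_fund, mul_one] at this

theorem exists_iterated_directional_derivative {N : ℕ} {v : Pt} (hv : ‖v‖ ≤ 1) (j : ℕ)
    {a : Pt → ℂ} {M : ℝ} (ha : ContDiff ℝ (⊤ : ℕ∞) a) (hp : IsPeriodic a)
    (h : DerivBound (N + j) a M) :
    ∃ b : Pt → ℂ, ContDiff ℝ (⊤ : ℕ∞) b ∧ IsPeriodic b ∧ DerivBound N b M ∧ ∀ n,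
      planeCoeff b n = ((2 * π * (n.1 * v.1 + n.2 * v.2) : ℝ) * I) ^ j * planeCoeff a n := by
  induction j generalizing a with
  | zero => exact ⟨a, ha, hp, h, fun n ↦ by simp⟩
  | succ j ih =>
    obtain ⟨b, hb, hbp, hbM, hbn⟩ := ih
      ((ha.fderiv_right (m := (⊤ : ℕ∞)) (by exact_mod_cast le_top)).clm_apply contDiff_const)
      (hp.fderiv_apply v) (h.fderiv_apply ha hv)
    refine ⟨b, hb, hbp, hbM, fun n ↦ ?_⟩
    rw [hbn, planeCoeff_fderiv (ha.of_le (by exact_mod_cast le_top)) hp, pow_succ, mul_assoc (_ ^ j)]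

theorem DerivBound.mono {N N' : ℕ} {a : Pt → ℂ} {M : ℝ} (h : DerivBound N a M) (hN : N' ≤ N) :
    DerivBound N' a M := fun k hk ↦ h k (hk.trans hN)

theorem DerivBound.norm_planeCoeff_mul_le {a : Pt → ℂ} {M : ℝ} (ha : ContDiff ℝ (⊤ : ℕ∞) a)
    (hp : IsPeriodic a) (h : DerivBound 6 a M) (n : ℤ × ℤ) :
    ‖planeCoeff a n‖ * ((1 + |(n.1 : ℝ)|) * (1 + |(n.2 : ℝ)|)) ^ 3 ≤ 64 * M := by
  have key : ∀ j ≤ 3, ∀ k ≤ 3, |(n.1 : ℝ)| ^ j * |(n.2 : ℝ)| ^ k * ‖planeCoeff a n‖ ≤ M := by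
    intro j hj k hk
    obtain ⟨b, hb, hbp, hbM, hbn⟩ := exists_iterated_directional_derivative (N := k)
      (v := (1, 0)) (by simp) j ha hp (h.mono (by lia))
    obtain ⟨c, -, -, hcM, hcn⟩ := exists_iterated_directional_derivative (N := 0)
      (v := (0, 1)) (by simp) k hb hbp (by simpa using hbM)
    have := hcM.norm_planeCoeff_le n
    rw [hcn, hbn] at this
    simp only [mul_one, mul_zero, add_zero, zero_add, norm_mul, norm_pow, norm_I, norm_real,
      Real.norm_eq_abs, ← mul_assoc] at this
    refine le_trans ?_ this
    have hle : ∀ t : ℝ, |t| ≤ |2| * |π| * |t| := fun t ↦ by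
      rw [abs_of_pos Real.pi_pos, abs_two]
      nlinarith [Real.pi_gt_three, abs_nonneg t]
    rw [mul_comm (|(n.1 : ℝ)| ^ j)]
    gcongr <;> exact hle _
  have h00 := key 0 (by simp) 0 (by simp)
  have h30 := key 3 le_rfl 0 (by simp)
  have h03 := key 0 (by simp) 3 le_rfl
  have h33 := key 3 le_rfl 3 le_rfl
  have hcube : ∀ t : ℝ, 0 ≤ t → (1 + t) ^ 3 ≤ 4 * (1 + t ^ 3) := fun t ht ↦ by
    nlinarith [mul_nonneg (by linarith : 0 ≤ 1 + t) (sq_nonneg (1 - t))]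
  calc _ ≤ ‖planeCoeff a n‖ * ((4 * (1 + |(n.1 : ℝ)| ^ 3)) * (4 * (1 + |(n.2 : ℝ)| ^ 3))) := by
        rw [mul_pow]
        gcongr <;> exact hcube _ (abs_nonneg _)
    _ ≤ 64 * M := by linarith

theorem derivBound_CNorm {a : Pt → ℂ} (ha : ContDiff ℝ (⊤ : ℕ∞) a) (N : ℕ) :
    DerivBound N a (CNorm N a) := fun k hk x hx ↦ by
  have hbdd : BddAbove (Set.range fun y : fund ↦ ‖iteratedFDeriv ℝ k a (y : Pt)‖) := by
    obtain ⟨C, hC⟩ := isCompact_fund.exists_bound_of_continuousOn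
      (ha.continuous_iteratedFDeriv (m := k) (by exact_mod_cast le_top)).continuousOn
    exact ⟨C, by rintro _ ⟨y, rfl⟩; exact hC y y.2⟩
  refine (le_ciSup hbdd ⟨x, hx⟩).trans ?_
  exact le_ciSup (f := fun k : Fin (N + 1) ↦ ⨆ y : fund, ‖iteratedFDeriv ℝ (k : ℕ) a (y : Pt)‖)
    (Set.finite_range _).bddAbove ⟨k, by lia⟩

theorem mFourier_coe (n : Fin 2 → ℤ) (x : Fin 2 → ℝ) :
    UnitAddTorus.mFourier n (fun i ↦ (x i : UnitAddCircle)) = planeChar (n 0, n 1) (x 0, x 1) := by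
  simp only [UnitAddTorus.mFourier, ContinuousMap.coe_mk, Fin.prod_univ_two, fourier_coe_apply,
    planeChar, ← Complex.exp_add]
  congr 1
  push_cast
  ring

/-- A periodic continuous function of the plane descends to the torus. -/
theorem IsPeriodic.exists_torus_lift {a : Pt → ℂ} (hp : IsPeriodic a) (ha : Continuous a) :
    ∃ f : C(UnitAddTorus (Fin 2), ℂ), ∀ x : Fin 2 → ℝ,
      f (fun i ↦ (x i : UnitAddCircle)) = a (x 0, x 1) := by
  have hq : IsOpenQuotientMap fun (x : Fin 2 → ℝ) (i : Fin 2) ↦ (x i : UnitAddCircle) :=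
    IsOpenQuotientMap.piMap fun _ ↦ QuotientAddGroup.isOpenQuotientMap_mk
  have hcomp : ∀ x y : Fin 2 → ℝ, (fun i ↦ (x i : UnitAddCircle)) = (fun i ↦ (y i : UnitAddCircle))
      → a (x 0, x 1) = a (y 0, y 1) := by
    intro x y h
    have hm : ∀ i, ∃ m : ℤ, y i + m = x i := fun i ↦ by
      have hi : ((x i - y i : ℝ) : UnitAddCircle) = 0 := by
        rw [AddCircle.coe_sub, sub_eq_zero]
        exact congrFun h i
      obtain ⟨m, hm⟩ := (AddCircle.coe_eq_zero_iff _).1 hi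
      refine ⟨m, ?_⟩
      rw [zsmul_one] at hm
      linarith
    obtain ⟨m0, h0⟩ := hm 0
    obtain ⟨m1, h1⟩ := hm 1
    rw [← h0, ← h1]
    exact hp (m0, m1) (y 0, y 1)
  let q : C(Fin 2 → ℝ, UnitAddTorus (Fin 2)) := ⟨_, hq.continuous⟩
  have hq' : IsQuotientMap q := hq.isQuotientMap
  let F : C(Fin 2 → ℝ, ℂ) := ⟨fun x ↦ a (x 0, x 1), by fun_prop⟩
  have hF : Function.FactorsThrough F q := fun x y h ↦ hcomp x y h
  exact ⟨hq'.lift F hF, fun x ↦ congrArg (fun g : C(Fin 2 → ℝ, ℂ) ↦ g x) (hq'.lift_comp F hF)⟩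

theorem setIntegral_fund_eq_pi {a : Pt → ℂ} :
    ∫ x in {x : Fin 2 → ℝ | ∀ i, x i ∈ Set.Ioc ((0 : Fin 2 → ℝ) i) ((0 : Fin 2 → ℝ) i + 1)},
      a (x 0, x 1) = ∫ x in fund, a x := by
  have h := (volume_preserving_finTwoArrow ℝ).setIntegral_preimage_emb
    (MeasurableEquiv.finTwoArrow).measurableEmbedding a (Set.Ioc 0 1 ×ˢ Set.Ioc 0 1)
  have hset : (MeasurableEquiv.finTwoArrow : (Fin 2 → ℝ) ≃ᵐ ℝ × ℝ) ⁻¹' (Set.Ioc 0 1 ×ˢ Set.Ioc 0 1) =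
      {x : Fin 2 → ℝ | ∀ i, x i ∈ Set.Ioc ((0 : Fin 2 → ℝ) i) ((0 : Fin 2 → ℝ) i + 1)} := by
    ext x; simp [Fin.forall_fin_two]
  rw [hset] at h
  have hae : (Set.Ioc (0 : ℝ) 1 ×ˢ Set.Ioc (0 : ℝ) 1 : Set Pt) =ᵐ[volume] fund := by
    rw [fund_eq_prod, Measure.volume_eq_prod]
    exact Measure.set_prod_ae_eq Ioc_ae_eq_Icc Ioc_ae_eq_Icc
  rw [setIntegral_congr_set hae] at h
  exact h

/-- Fourier inversion for periodic functions of the plane. -/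
theorem IsPeriodic.hasSum_planeCoeff {a : Pt → ℂ} (hp : IsPeriodic a) (ha : Continuous a)
    (hs : Summable (planeCoeff a)) (x : Pt) :
    HasSum (fun n ↦ planeCoeff a n * planeChar n x) (a x) := by
  obtain ⟨f, hf⟩ := hp.exists_torus_lift ha
  have hcoeff : ∀ n : Fin 2 → ℤ, UnitAddTorus.mFourierCoeff f n = planeCoeff a (n 0, n 1) := by
    intro n
    rw [UnitAddTorus.mFourierCoeff_eq_integral f n 0, planeCoeff, ← setIntegral_fund_eq_pi]
    simp only [mFourier_coe, hf, smul_eq_mul]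
    rfl
  have hs' : Summable (UnitAddTorus.mFourierCoeff f) := by
    rw [funext hcoeff]
    exact (finTwoArrowEquiv ℤ).summable_iff.2 hs
  have h := UnitAddTorus.hasSum_mFourier_series_apply_of_summable hs'
    (fun i ↦ ((![x.1, x.2] i : ℝ) : UnitAddCircle))
  simp only [hcoeff, mFourier_coe, hf, smul_eq_mul] at h
  exact (finTwoArrowEquiv ℤ).hasSum_iff.1 h

theorem summable_int_weight : Summable fun n : ℤ ↦ ((1 + |(n : ℝ)|) ^ 2)⁻¹ := by
  refine Summable.of_nonneg_of_le (fun n ↦ by positivity) (fun n ↦ ?_)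
    ((Real.summable_one_div_int_add_rpow (1 / 2) 2).2 one_lt_two)
  have h0 : (n : ℝ) + 1 / 2 ≠ 0 := by
    intro h
    have : (2 * n + 1 : ℤ) = 0 := by exact_mod_cast (by linarith : 2 * (n : ℝ) + 1 = 0)
    lia
  have h1 : |(n : ℝ) + 1 / 2| ≤ 1 + |(n : ℝ)| := 
    (abs_add_le _ _).trans (by norm_num [abs_of_pos]; linarith)
  have h2 : 0 < |(n : ℝ) + 1 / 2| := abs_pos.2 h0
  rw [one_div, Real.rpow_two]
  gcongr

theorem summable_int_prod_weight :
    Summable fun n : ℤ × ℤ ↦ (((1 + |(n.1 : ℝ)|) * (1 + |(n.2 : ℝ)|)) ^ 2)⁻¹ := by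
  simp only [mul_pow, mul_inv]
  exact summable_int_weight.mul_of_nonneg summable_int_weight (fun _ ↦ by positivity)
    fun _ ↦ by positivity

/-- Pairing the Fourier expansion of a smooth function with a bounded density. -/
theorem IsPeriodic.hasSum_integral_mul {a : Pt → ℂ} (hp : IsPeriodic a) (ha : Continuous a)
    (hs : Summable fun n ↦ ‖planeCoeff a n‖) {w : Pt → ℂ} (hw : Continuous w) :
    HasSum (fun n ↦ planeCoeff a n * ∫ x in fund, planeChar n x * w x)
      (∫ x in fund, a x * w x) := by
  have hχ : ∀ n, Continuous (planeChar n) := fun n ↦ (contDiff_planeChar n (k := 0)).continuous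
  have hsum : ∀ x, HasSum (fun n ↦ planeCoeff a n * (planeChar n x * w x)) (a x * w x) := fun x ↦ by
    simpa only [mul_assoc] using (hp.hasSum_planeCoeff ha hs.of_norm x).mul_right (w x)
  have h := hasSum_integral_of_summable_integral_norm (μ := volume.restrict fund)
    (F := fun n x ↦ planeCoeff a n * (planeChar n x * w x))
    (fun n ↦ integrableOn_fund (by have := hχ n; fun_prop)) (by
      simp only [norm_mul, norm_planeChar, one_mul, integral_const_mul]
      exact hs.mul_right _)
  simp only [fun x ↦ (hsum x).tsum_eq, integral_const_mul] at h
  exact h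

theorem norm_integral_mul_sub_le {B : ℝ} {α : Pt} {u : Pt → ℂ} (hB : 0 < B) (hu : MemCL B u)
    {l : ℝ} (hl0 : 0 ≤ l) (hl : ∀ x, magLap α (A0 B) u x = ((l ^ 2 : ℝ) : ℂ) * u x)
    (h1 : ∫ x in fund, ‖u x‖ ^ 2 = 1) {a : Pt → ℂ} (ha : ContDiff ℝ (⊤ : ℕ∞) a)
    (hp : IsPeriodic a) :
    ‖(∫ x in fund, a x * ((‖u x‖ ^ 2 : ℝ) : ℂ)) - ∫ x in fund, a x‖ ≤
      (√(8 + 2 * B) * 64 * ∑' n : ℤ × ℤ, (((1 + |(n.1 : ℝ)|) * (1 + |(n.2 : ℝ)|)) ^ 2)⁻¹) *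
        CNorm 6 a * (1 + l) ^ (-(1 / 2) : ℝ) := by
  set M : ℤ × ℤ → ℝ := fun n ↦ (1 + |(n.1 : ℝ)|) * (1 + |(n.2 : ℝ)|) with hM
  have hM1 : ∀ n, 1 ≤ M n := fun n ↦ by
    simp only [hM]; nlinarith [abs_nonneg (n.1 : ℝ), abs_nonneg (n.2 : ℝ)]
  have hM0 : ∀ n, 0 < M n := fun n ↦ one_pos.trans_le (hM1 n)
  have hMs : Summable fun n ↦ (M n ^ 2)⁻¹ := summable_int_prod_weight
  have hcoef : ∀ n, ‖planeCoeff a n‖ * M n ≤ 64 * CNorm 6 a * (M n ^ 2)⁻¹ := fun n ↦ by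
    rw [← div_eq_mul_inv, le_div_iff₀ (pow_pos (hM0 n) 2)]
    have := (derivBound_CNorm ha 6).norm_planeCoeff_mul_le ha hp n
    linarith
  have hs : Summable fun n ↦ ‖planeCoeff a n‖ :=
    .of_nonneg_of_le (fun _ ↦ norm_nonneg _)
      (fun n ↦ (le_mul_of_one_le_right (norm_nonneg _) (hM1 n)).trans (hcoef n)) (hMs.mul_left _)
  have huc := hu.continuous
  have hsum := hp.hasSum_integral_mul ha.continuous hs
    (w := fun x ↦ ((‖u x‖ ^ 2 : ℝ) : ℂ)) (by fun_prop)
  set T : ℤ × ℤ → ℂ := fun n ↦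
    planeCoeff a n * ∫ x in fund, planeChar n x * ((‖u x‖ ^ 2 : ℝ) : ℂ)
  have hT0 : T 0 = ∫ x in fund, a x := by
    simp only [T, planeCoeff, planeChar, neg_zero, Prod.fst_zero, Prod.snd_zero, Int.cast_zero,
      zero_mul, add_zero, mul_zero, ofReal_zero, Complex.exp_zero, one_mul, integral_complex_ofReal,
      h1, ofReal_one, mul_one]
  have hupd := hsum.update 0 0
  rw [hT0, zero_sub, neg_add_eq_sub] at hupd
  refine hupd.norm_le_of_bounded ((hMs.hasSum.mul_left (√(8 + 2 * B) * 64)).mul_right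
    (CNorm 6 a) |>.mul_right ((1 + l) ^ (-(1 / 2) : ℝ))) fun n ↦ ?_
  have hl1 : 0 ≤ (1 + l) ^ (-(1 / 2) : ℝ) := Real.rpow_nonneg (by linarith) _
  have hnn : 0 ≤ 64 * CNorm 6 a * (M n ^ 2)⁻¹ :=
    (mul_nonneg (norm_nonneg _) (hM0 n).le).trans (hcoef n)
  obtain rfl | hn := eq_or_ne n 0
  · rw [Function.update_self, norm_zero]
    exact (by positivity : 0 ≤ √(8 + 2 * B) * (64 * CNorm 6 a * (M 0 ^ 2)⁻¹) *
      (1 + l) ^ (-(1 / 2) : ℝ)).trans_eq (by ring)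
  · rw [Function.update_of_ne hn, norm_mul]
    calc _ ≤ ‖planeCoeff a n‖ * (√(8 + 2 * B) * M n * (1 + l) ^ (-(1 / 2) : ℝ)) :=
          mul_le_mul_of_nonneg_left (norm_integral_planeChar_mul_le hB hu hl0 hl h1 hn)
            (norm_nonneg _)
      _ = √(8 + 2 * B) * (‖planeCoeff a n‖ * M n) * (1 + l) ^ (-(1 / 2) : ℝ) := by ring
      _ ≤ √(8 + 2 * B) * (64 * CNorm 6 a * (M n ^ 2)⁻¹) * (1 + l) ^ (-(1 / 2) : ℝ) := by
          exact mul_le_mul_of_nonneg_right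
            (mul_le_mul_of_nonneg_left (hcoef n) (Real.sqrt_nonneg _)) hl1
      _ = _ := by ring

end

/-- Theorem 1.2 of Morin–Rivière: quantitative quantum unique
ergodicity for a constant magnetic field `B ≡ B̂₀ > 0` and `V ≡ 0`. -/
theorem statement1
    (B0 : ℝ) (hB0pos : 0 < B0) (hflux : ∃ k : ℤ, B0 = 2 * π * k) (α : Pt) :
    ∃ C0 : ℝ, 0 < C0 ∧ ∃ N0 : ℕ,
      ∀ lam : ℝ, 0 ≤ lam →
        ∀ u : Pt → ℂ, MemCL B0 u →
          (∀ x, magLap α (A0 B0) u x = ((lam ^ 2 : ℝ) : ℂ) * u x) →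
          (∫ x in fund, ‖u x‖ ^ 2) = 1 →
          ∀ a : Pt → ℂ, ContDiff ℝ (⊤ : ℕ∞) a → IsPeriodic a →
            ‖(∫ x in fund, a x * ((‖u x‖ ^ 2 : ℝ) : ℂ)) - ∫ x in fund, a x‖ ≤
              C0 * CNorm N0 a * (1 + lam) ^ (-(1 / 2) : ℝ) := by
  refine ⟨√(8 + 2 * B0) * 64 *
      ∑' n : ℤ × ℤ, (((1 + |(n.1 : ℝ)|) * (1 + |(n.2 : ℝ)|)) ^ 2)⁻¹, ?_, 6,
    fun lam hlam u hu heig h1 a ha hp ↦ norm_integral_mul_sub_le hB0pos hu hlam heig h1 ha hp⟩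
  have hS := summable_int_prod_weight.tsum_pos (fun n ↦ by positivity) 0 (by simp)
  positivity
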